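/- arXiv:1702.02459 — 3 statements merged into one kernel-verified Lean document; each statement's English description precedes it below -/
import Mathlib

section
/- The Euclidean topology E on Minkowski space M = ℝ⁴ is strictly coarser than the Zeeman topology Z; that is, every E-open set is Z-open, and there exists a Z-open set that is not E-open (for example, (B_E(x,r) \ N(x)) ∪ {x} for any point x and radius r > 0). -/
noncomputable section

/-- Minkowski space: `ℝ⁴` with the Euclidean (norm) topology as its
standard topology. -/
abbrev M4 : Type := EuclideanSpace ℝ (Fin 4)

/-- The Minkowski quadratic form `Q(x) = x₀² − x₁² − x₂² − x₃²`. -/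
def Q (x : M4) : ℝ := x 0 ^ 2 - x 1 ^ 2 - x 2 ^ 2 - x 3 ^ 2

/-- The light cone of a point `x`. -/
def lightCone (x : M4) : Set M4 := {y : M4 | y ≠ x ∧ Q (y - x) = 0}

/-- The basic Zeeman neighbourhood `(B_E(x,r) \ N(x)) ∪ {x}`. -/
def zeemanBall (x : M4) (r : ℝ) : Set M4 :=
  (Metric.ball x r \ lightCone x) ∪ {x}

/-- The Zeeman topology `Z`, generated by the sets `(B_E(x,r) \ N(x)) ∪ {x}`. -/
def Ztop : TopologicalSpace M4 :=
  TopologicalSpace.generateFrom {s : Set M4 | ∃ x : M4, ∃ r : ℝ, 0 < r ∧ s = zeemanBall x r}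

theorem self_mem_zeemanBall (x : M4) (r : ℝ) : x ∈ zeemanBall x r :=
  Or.inr rfl

theorem zeemanBall_subset_ball (x : M4) {r : ℝ} (hr : 0 < r) :
    zeemanBall x r ⊆ Metric.ball x r :=
  Set.union_subset Set.sdiff_subset (Set.singleton_subset_iff.2 (Metric.mem_ball_self hr))

theorem isOpen_zeemanBall (x : M4) {r : ℝ} (hr : 0 < r) : Ztop.IsOpen (zeemanBall x r) :=
  TopologicalSpace.GenerateOpen.basic _ ⟨x, r, hr, rfl⟩

theorem Ztop_isOpen_of_isOpen {U : Set M4} (hU : IsOpen U) : Ztop.IsOpen U := by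
  have hUnion : U = ⋃₀ {s | Ztop.IsOpen s ∧ s ⊆ U} := by
    refine Set.Subset.antisymm (fun x hx => ?_) (Set.sUnion_subset fun s hs => hs.2)
    obtain ⟨r, hr, hball⟩ := Metric.isOpen_iff.1 hU x hx
    exact ⟨zeemanBall x r,
      ⟨isOpen_zeemanBall x hr, (zeemanBall_subset_ball x hr).trans hball⟩,
      self_mem_zeemanBall x r⟩
  rw [hUnion]
  exact Ztop.isOpen_sUnion _ fun s hs => hs.1

/-- Every point of the null line through `x` in the direction `(1, 1, 0, 0)`, other than `x`
itself, lies on the light cone of `x`. -/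
theorem add_smul_null_mem_lightCone (x : M4) {t : ℝ} (ht : t ≠ 0) :
    x + t • (!₂[1, 1, 0, 0] : M4) ∈ lightCone x := by
  refine ⟨fun h => ht ?_, by simp [Q]⟩
  simpa using congrArg (fun y : M4 => y 0) h

theorem not_isOpen_zeemanBall (x : M4) (r : ℝ) : ¬ IsOpen (zeemanBall x r) := by
  intro hopen
  have hcont : Continuous fun t : ℝ => x + t • (!₂[1, 1, 0, 0] : M4) := by fun_prop
  have hmem : (fun t : ℝ => x + t • (!₂[1, 1, 0, 0] : M4)) ⁻¹' zeemanBall x r ∈ nhds 0 :=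
    (hopen.preimage hcont).mem_nhds (by simpa using self_mem_zeemanBall x r)
  obtain ⟨ε, hε, hball⟩ := Metric.mem_nhds_iff.1 hmem
  have hhalf : ε / 2 ∈ Metric.ball (0 : ℝ) ε := by
    rw [mem_ball_zero_iff, Real.norm_of_nonneg (half_pos hε).le]
    exact half_lt_self hε
  have hcone := add_smul_null_mem_lightCone x (half_pos hε).ne'
  rcases hball hhalf with h | h
  · exact h.2 hcone
  · exact hcone.1 h

/-- The Euclidean topology `E` on Minkowski space is strictly coarser than the
Zeeman topology `Z`: every `E`-open set is `Z`-open, and some `Z`-open set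
(e.g. any basic Zeeman ball) fails to be `E`-open. -/
theorem euclidean_strictly_coarser_than_zeeman :
    (∀ U : Set M4, IsOpen U → Ztop.IsOpen U) ∧
    (∃ U : Set M4, Ztop.IsOpen U ∧ ¬ IsOpen U) ∧
    (∀ (x : M4) (r : ℝ), 0 < r →
      Ztop.IsOpen (zeemanBall x r) ∧ ¬ IsOpen (zeemanBall x r)) :=
  ⟨fun _ => Ztop_isOpen_of_isOpen,
    ⟨zeemanBall 0 1, isOpen_zeemanBall 0 one_pos, not_isOpen_zeemanBall 0 1⟩,
    fun x r hr => ⟨isOpen_zeemanBall x hr, not_isOpen_zeemanBall x r⟩⟩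
end
end

section
/- The Zeeman topology Z on Minkowski space M = ℝ⁴ is strictly coarser than the fine Zeeman topology F; that is, every Z-open set is F-open, and there exists an F-open set that is not Z-open. -/
noncomputable section

/-- `A` is a time axis (a line with timelike direction) or a space axis
(a translate of a 3-dimensional subspace on which `Q` is negative definite). -/
def IsAxis (A : Set M4) : Prop :=
  (∃ x v : M4, 0 < Q v ∧ A = {p : M4 | ∃ t : ℝ, p = x + t • v}) ∨
  (∃ (x : M4) (W : Submodule ℝ M4), Module.finrank ℝ W = 3 ∧
    (∀ w ∈ W, w ≠ 0 → Q w < 0) ∧ A = {p : M4 | ∃ w ∈ W, p = x + w})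

/-- The fine Zeeman topology `F`: the finest topology on `M4` inducing the
Euclidean subspace topology on every time axis and every space axis.
A set `U` is `F`-open iff its preimage in every axis `A` (with the Euclidean
subspace topology) is open. -/
def Ftop : TopologicalSpace M4 :=
  ⨆ A : {A : Set M4 // IsAxis A},
    TopologicalSpace.coinduced (Subtype.val : A.1 → M4) inferInstance

open Topology Filter

lemma continuous_Q : Continuous Q := by
  unfold Q
  fun_prop

lemma Q_smul (t : ℝ) (v : M4) : Q (t • v) = t ^ 2 * Q v := by
  simp only [Q, PiLp.smul_apply, smul_eq_mul]
  ring

/-- Distinct points of an axis are never lightlike separated. -/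
lemma IsAxis.eq_of_Q_sub_eq_zero {A : Set M4} (hA : IsAxis A) {p q : M4}
    (hp : p ∈ A) (hq : q ∈ A) (h : Q (p - q) = 0) : p = q := by
  rcases hA with ⟨a, v, hv, rfl⟩ | ⟨a, W, -, hW, rfl⟩
  · obtain ⟨s, rfl⟩ := hp
    obtain ⟨t, rfl⟩ := hq
    rw [add_sub_add_left_eq_sub, ← sub_smul, Q_smul] at h
    have hst : s - t = 0 := by simpa [hv.ne'] using h
    rw [sub_eq_zero.mp hst]
  · obtain ⟨u, hu, rfl⟩ := hp
    obtain ⟨w, hw, rfl⟩ := hq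
    rw [add_sub_add_left_eq_sub] at h
    by_contra hne
    refine (hW _ (W.sub_mem hu hw) fun h0 => hne ?_).ne h
    rw [sub_eq_zero.mp h0]

lemma isOpen_Ftop_iff {U : Set M4} :
    IsOpen[Ftop] U ↔ ∀ A : Set M4, IsAxis A → IsOpen ((Subtype.val : A → M4) ⁻¹' U) := by
  unfold Ftop
  rw [isOpen_iSup_iff]
  simp only [isOpen_coinduced, Subtype.forall]

lemma isOpen_Ftop_zeemanBall (x : M4) (r : ℝ) (hr : 0 < r) : IsOpen[Ftop] (zeemanBall x r) := by
  refine isOpen_Ftop_iff.mpr fun A hA => ?_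
  by_cases hx : x ∈ A
  · have : (Subtype.val : A → M4) ⁻¹' zeemanBall x r = Subtype.val ⁻¹' Metric.ball x r := by
      ext ⟨y, hy⟩
      refine ⟨?_, fun h => Or.inl ⟨h, fun hc => hc.1 (hA.eq_of_Q_sub_eq_zero hy hx hc.2)⟩⟩
      rintro (h | rfl)
      · exact h.1
      · exact Metric.mem_ball_self hr
    rw [this]
    exact Metric.isOpen_ball.preimage continuous_subtype_val
  · have : (Subtype.val : A → M4) ⁻¹' zeemanBall x r =
        Subtype.val ⁻¹' (Metric.ball x r ∩ {y | Q (y - x) ≠ 0}) := by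
      ext ⟨y, hy⟩
      have hyx : y ≠ x := fun h => hx (h ▸ hy)
      simp [zeemanBall, lightCone, hyx]
    rw [this]
    exact (Metric.isOpen_ball.inter <| isOpen_ne_fun
      (continuous_Q.comp (continuous_id.sub continuous_const)) continuous_const).preimage
        continuous_subtype_val

/-- The sets `zeemanBall x ε` form a neighbourhood basis at `x` for the Zeeman topology. -/
lemma exists_zeemanBall_subset {U : Set M4} (hU : IsOpen[Ztop] U) {x : M4} (hx : x ∈ U) :
    ∃ ε > 0, zeemanBall x ε ⊆ U := by
  induction hU with
  | basic s hs =>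
    obtain ⟨y, r, hr, rfl⟩ := hs
    by_cases hxy : x = y
    · subst hxy
      exact ⟨r, hr, subset_rfl⟩
    · have hx' : x ∈ Metric.ball y r ∩ {z | Q (z - y) ≠ 0} := by
        simpa [zeemanBall, lightCone, hxy] using hx
      have ho : IsOpen (Metric.ball y r ∩ {z | Q (z - y) ≠ 0}) :=
        Metric.isOpen_ball.inter <| isOpen_ne_fun
          (continuous_Q.comp (continuous_id.sub continuous_const)) continuous_const
      obtain ⟨ε, hε, hsub⟩ := Metric.isOpen_iff.mp ho x hx'
      refine ⟨ε, hε, ?_⟩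
      rintro z (hz | rfl)
      · exact Or.inl ⟨(hsub hz.1).1, fun hc => (hsub hz.1).2 hc.2⟩
      · exact hx
  | univ => exact ⟨1, one_pos, Set.subset_univ _⟩
  | inter s t _ _ ihs iht =>
    obtain ⟨ε, hε, hs⟩ := ihs hx.1
    obtain ⟨δ, hδ, ht⟩ := iht hx.2
    have hmono {a b : ℝ} (hab : a ≤ b) : zeemanBall x a ⊆ zeemanBall x b :=
      Set.union_subset_union_left _ (Set.sdiff_subset_sdiff_left (Metric.ball_subset_ball hab))
    exact ⟨min ε δ, lt_min hε hδ, Set.subset_inter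
      ((hmono (min_le_left _ _)).trans hs) ((hmono (min_le_right _ _)).trans ht)⟩
  | sUnion S _ ih =>
    obtain ⟨s, hs, hxs⟩ := hx
    obtain ⟨ε, hε, hsub⟩ := ih s hs hxs
    exact ⟨ε, hε, hsub.trans (Set.subset_sUnion_of_mem hs)⟩

/-- A compact arc of a parabola through the origin, timelike except at the origin. -/
def parabolicArc : Set M4 := {p | p 1 = p 0 ^ 2 ∧ p 2 = 0 ∧ p 3 = 0 ∧ |p 0| ≤ 1 / 2}

lemma isClosed_parabolicArc : IsClosed parabolicArc := by
  have hc (i : Fin 4) : Continuous fun p : M4 => p i := by fun_prop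
  exact (isClosed_eq (hc 1) ((hc 0).pow 2)).inter <|
    (isClosed_eq (hc 2) continuous_const).inter <|
    (isClosed_eq (hc 3) continuous_const).inter <|
    isClosed_le (hc 0).abs continuous_const

lemma parabolicArc_ext {p q : M4} (hp : p ∈ parabolicArc) (hq : q ∈ parabolicArc)
    (h : p 0 = q 0) : p = q := by
  ext i
  fin_cases i
  · exact h
  · exact hp.1.trans ((congrArg (· ^ 2) h).trans hq.1.symm)
  · exact hp.2.1.trans hq.2.1.symm
  · exact hp.2.2.1.trans hq.2.2.1.symm

lemma zero_mem_parabolicArc : (0 : M4) ∈ parabolicArc := by simp [parabolicArc]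

lemma Q_pos_of_mem_parabolicArc {p : M4} (hp : p ∈ parabolicArc) (h0 : p ≠ 0) : 0 < Q p := by
  have hp0 : p 0 ≠ 0 := fun h => h0 (parabolicArc_ext hp zero_mem_parabolicArc h)
  obtain ⟨h1, h2, h3, h4⟩ := hp
  have hlt : p 0 ^ 2 < 1 := (sq_lt_one_iff_abs_lt_one _).mpr (by linarith)
  have : Q p = p 0 ^ 2 * (1 - p 0 ^ 2) := by
    rw [Q, h1, h2, h3]
    ring
  rw [this]
  exact mul_pos (by positivity) (by linarith)

/-- An axis through the origin meets the arc in at most one other point. -/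
lemma IsAxis.subsingleton_inter_parabolicArc {A : Set M4} (hA : IsAxis A) (h0 : (0 : M4) ∈ A) :
    (A ∩ (parabolicArc \ {0})).Subsingleton := by
  rintro p ⟨hpA, hp, hp0⟩ q ⟨hqA, hq, hq0⟩
  rw [Set.mem_singleton_iff] at hp0 hq0
  rcases hA with ⟨a, v, -, rfl⟩ | ⟨a, W, -, hW, rfl⟩
  · refine parabolicArc_ext hp hq ?_
    have hp0' : p 0 ≠ 0 := fun h => hp0 (parabolicArc_ext hp zero_mem_parabolicArc h)
    have hq0' : q 0 ≠ 0 := fun h => hq0 (parabolicArc_ext hq zero_mem_parabolicArc h)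
    obtain ⟨t, ht⟩ := h0
    obtain ⟨s, rfl⟩ := hpA
    obtain ⟨u, rfl⟩ := hqA
    obtain rfl : a = -(t • v) := eq_neg_of_add_eq_zero_left ht.symm
    have h1 := hp.1
    have h2 := hq.1
    simp only [PiLp.add_apply, PiLp.neg_apply, PiLp.smul_apply, smul_eq_mul] at h1 h2 hp0' hq0' ⊢
    refine mul_left_cancel₀ (mul_ne_zero hp0' hq0') ?_
    linear_combination (-(t * v 0) + s * v 0) * h2 - (-(t * v 0) + u * v 0) * h1
  · obtain ⟨w, hw, hw0⟩ := h0
    obtain ⟨u, hu, rfl⟩ := hpA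
    obtain rfl : a = -w := eq_neg_of_add_eq_zero_left hw0.symm
    exact absurd (hW _ (W.add_mem (W.neg_mem hw) hu) hp0) (Q_pos_of_mem_parabolicArc hp hp0).not_gt

lemma isOpen_Ftop_compl_parabolicArc : IsOpen[Ftop] (parabolicArc \ {0})ᶜ := by
  refine isOpen_Ftop_iff.mpr fun A hA => ?_
  rw [Set.preimage_compl, isOpen_compl_iff, ← Subtype.preimage_coe_self_inter]
  by_cases h0 : (0 : M4) ∈ A
  · exact (hA.subsingleton_inter_parabolicArc h0).isClosed.preimage continuous_subtype_val
  · have : A ∩ (parabolicArc \ {0}) = A ∩ parabolicArc := by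
      ext y
      have : y ∈ A → y ≠ 0 := fun hy h => h0 (h ▸ hy)
      simp only [Set.mem_inter_iff, Set.mem_sdiff, Set.mem_singleton_iff]
      tauto
    rw [this, Subtype.preimage_coe_self_inter]
    exact isClosed_parabolicArc.preimage continuous_subtype_val

lemma not_isOpen_Ztop_compl_parabolicArc : ¬ IsOpen[Ztop] (parabolicArc \ {0})ᶜ := by
  intro hU
  obtain ⟨ε, hε, hsub⟩ := exists_zeemanBall_subset hU (x := 0) (by simp)
  let γ : ℝ → M4 := fun δ => !₂[δ, δ ^ 2, 0, 0]
  have hγ : Continuous γ := by fun_prop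
  have hγ0 : γ 0 = 0 := by
    ext i
    fin_cases i <;> simp [γ]
  have hball : ∀ᶠ δ in 𝓝[>] (0 : ℝ), γ δ ∈ Metric.ball 0 ε :=
    (hγ.tendsto' 0 0 hγ0).mono_left nhdsWithin_le_nhds |>.eventually (Metric.ball_mem_nhds 0 hε)
  obtain ⟨δ, hδ, hδ0, hδ1⟩ :=
    (hball.and (Ioo_mem_nhdsGT (show (0 : ℝ) < 1 / 2 by norm_num))).exists
  have harc : γ δ ∈ parabolicArc := by
    refine ⟨rfl, rfl, rfl, ?_⟩
    change |δ| ≤ 1 / 2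
    rw [abs_of_pos hδ0]
    exact hδ1.le
  have hne : γ δ ≠ 0 := fun h => hδ0.ne' (congrArg (fun p : M4 => p 0) h)
  refine hsub (Or.inl ⟨hδ, fun hc => ?_⟩) ⟨harc, hne⟩
  exact (Q_pos_of_mem_parabolicArc harc hne).ne' (by simpa using hc.2)

/-- The Zeeman topology `Z` is strictly coarser than the fine Zeeman topology
`F`: every `Z`-open set is `F`-open, and some `F`-open set is not `Z`-open. -/
theorem zeeman_strictly_coarser_than_fine :
    (∀ U : Set M4, Ztop.IsOpen U → Ftop.IsOpen U) ∧
    (∃ U : Set M4, Ftop.IsOpen U ∧ ¬ Ztop.IsOpen U) := by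
  refine ⟨?_, _, isOpen_Ftop_compl_parabolicArc, not_isOpen_Ztop_compl_parabolicArc⟩
  have hle : Ftop ≤ Ztop := by
    refine le_generateFrom ?_
    rintro _ ⟨x, r, hr, rfl⟩
    exact isOpen_Ftop_zeemanBall x r hr
  exact hle
end
end

section
/- (Theorem 2.1) Let f : [0,1] → M be a map from the unit interval into Minkowski space M = ℝ⁴ that is continuous with respect to the fine Zeeman topology F on M, and strictly order-preserving with respect to the chronological order (i.e., s < t in [0,1] implies f(s) ≪ f(t)). Then the image f([0,1]) is a piecewise linear path consisting of a finite number of intervals along time axes: there exist 0 = t₀ < t₁ < ⋯ < tₙ = 1 such that for each i, the image f([tᵢ, tᵢ₊₁]) is the straight-line segment from f(tᵢ) to f(tᵢ₊₁) and f(tᵢ₊₁) − f(tᵢ) is a timelike vector (Q(f(tᵢ₊₁) − f(tᵢ)) > 0). -/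
noncomputable section

/-- The chronological order on Minkowski space: `x ≪ y` iff `y − x` is
timelike and future-pointing. -/
def Chron (x y : M4) : Prop := 0 < Q (y - x) ∧ 0 < (y - x) 0

open Set Filter Topology

theorem Q_neg (x : M4) : Q (-x) = Q x := by
  simp [Q]

theorem Ftop_le_euclidean : Ftop ≤ (inferInstance : TopologicalSpace M4) :=
  iSup_le fun _ => continuous_iff_coinduced_le.mp continuous_subtype_val

theorem isClosed_Ftop_of_forall_axis {S : Set M4}
    (h : ∀ A, IsAxis A → IsClosed (S ∩ A)) : IsClosed[Ftop] S := by
  rw [Ftop, isClosed_iSup_iff]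
  rintro ⟨A, hA⟩
  rw [isClosed_coinduced]
  have := (h A hA).preimage (continuous_subtype_val (p := (· ∈ A)))
  rwa [preimage_inter, Subtype.coe_preimage_self, inter_univ] at this

/-- The multiple of `x` with unit time coordinate (zero when `x 0 = 0`). -/
def timeDirection (x : M4) : M4 := (x 0)⁻¹ • x

theorem smul_timeDirection {x : M4} (hx : x 0 ≠ 0) : x 0 • timeDirection x = x := by
  rw [timeDirection, smul_inv_smul₀ hx]

theorem timeDirection_smul {c : ℝ} (hc : c ≠ 0) (v : M4) :
    timeDirection (c • v) = timeDirection v := by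
  simp only [timeDirection, PiLp.smul_apply, smul_eq_mul, smul_smul]
  congr 1
  field_simp

theorem isClosed_line (x v : M4) : IsClosed {p : M4 | ∃ t : ℝ, p = x + t • v} := by
  have h := (Submodule.closed_of_finiteDimensional (Submodule.span ℝ {v})).preimage
    (continuous_id.sub continuous_const : Continuous fun p : M4 => p - x)
  convert h using 1
  ext p
  simp only [mem_ofPred_eq, mem_preimage, SetLike.mem_coe, Submodule.mem_span_singleton]
  exact exists_congr fun t => ⟨fun h => by simp [h], fun h => by simp [h]⟩

/-- A sequence of pairwise timelike related points that converges to `p` in the Euclidean topology,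
seen from `p` in pairwise distinct directions, has `F`-closed range. -/
theorem isClosed_Ftop_range {u : ℕ → M4} {p : M4} (hu : Tendsto u atTop (𝓝 p))
    (htime : ∀ m n, u m ≠ u n → 0 < Q (u m - u n)) (hne : ∀ n, (u n - p) 0 ≠ 0)
    (hdir : Function.Injective fun n => timeDirection (u n - p)) :
    IsClosed[Ftop] (range u) := by
  refine isClosed_Ftop_of_forall_axis fun A hA => ?_
  rcases hA with ⟨x, v, -, rfl⟩ | ⟨x, W, -, hW, rfl⟩
  · by_cases hp : ∃ t : ℝ, p = x + t • v
    · obtain ⟨t, ht⟩ := hp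
      have key : ∀ n, (∃ s : ℝ, u n = x + s • v) →
          timeDirection (u n - p) = timeDirection v := by
        rintro n ⟨s, hs⟩
        have hsub : u n - p = (s - t) • v := by rw [hs, ht]; module
        have hst : s - t ≠ 0 := by
          intro h0
          exact hne n (by simp [hsub, h0])
        rw [hsub, timeDirection_smul hst]
      refine Set.Subsingleton.isClosed ?_
      rintro _ ⟨⟨m, rfl⟩, hm⟩ _ ⟨⟨n, rfl⟩, hn⟩
      exact congrArg u (hdir ((key m hm).trans (key n hn).symm))
    · have h := hu.isCompact_insert_range.isClosed.inter (isClosed_line x v)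
      rwa [insert_inter_of_notMem (show p ∉ {q : M4 | ∃ t : ℝ, q = x + t • v} from hp)] at h
  · refine Set.Subsingleton.isClosed ?_
    rintro _ ⟨⟨m, rfl⟩, w, hw, hm⟩ _ ⟨⟨n, rfl⟩, w', hw', hn⟩
    by_contra hmn
    have hsub : u m - u n = w - w' := by rw [hm, hn]; module
    have hpos := htime m n hmn
    have hneg := hW _ (W.sub_mem hw hw') (hsub ▸ sub_ne_zero.mpr hmn)
    rw [hsub] at hpos
    exact lt_asymm hpos hneg

/-- A function with infinite image on every member of a countably generated filter is injective
along some sequence tending to that filter. -/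
theorem exists_seq_tendsto_injective_comp {α β : Type*} {l : Filter α} [l.IsCountablyGenerated]
    {d : α → β} (h : ∀ s ∈ l, (d '' s).Infinite) :
    ∃ u : ℕ → α, Tendsto u atTop l ∧ Function.Injective (d ∘ u) := by
  obtain ⟨b, hb⟩ := l.exists_antitone_basis
  obtain ⟨u, hu, hr⟩ := exists_seq_of_forall_finset_exists
    (fun x : ℕ × α => x.2 ∈ b x.1) (fun x y => x.1 < y.1 ∧ d x.2 ≠ d y.2) (by
      classical
      intro s _
      obtain ⟨n, hn⟩ : ∃ n, ∀ x ∈ s, x.1 < n :=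
        ⟨s.sup Prod.fst + 1, fun x hx => Nat.lt_succ_of_le (Finset.le_sup (f := Prod.fst) hx)⟩
      obtain ⟨_, ⟨y, hy, rfl⟩, hys⟩ :=
        (h (b n) (hb.1.mem_of_mem trivial)).exists_notMem_finset (s.image fun x => d x.2)
      refine ⟨(n, y), hy, fun x hx => ⟨hn x hx, fun hxy => hys ?_⟩⟩
      exact Finset.mem_image.mpr ⟨x, hx, hxy⟩)
  have hmono : StrictMono fun n => (u n).1 := fun m n hmn => (hr m n hmn).1
  refine ⟨fun n => (u n).2, hb.tendsto fun n => hb.2 (hmono.id_le n) (hu n), ?_⟩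
  intro m n hmn
  by_contra hne
  rcases lt_or_gt_of_ne hne with hlt | hlt
  · exact (hr m n hlt).2 hmn
  · exact (hr n m hlt).2 hmn.symm

theorem image_Icc_eq_segment {E : Type*} [AddCommGroup E] [Module ℝ E] {f : ℝ → E} {h : ℝ → ℝ}
    {a b : ℝ} {p v : E} (hab : a ≤ b) (hc : ContinuousOn h (Icc a b))
    (hm : MonotoneOn h (Icc a b)) (hf : ∀ s ∈ Icc a b, f s = p + h s • v) :
    f '' Icc a b = segment ℝ (f a) (f b) := by
  have himg : h '' Icc a b = segment ℝ (h a) (h b) := by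
    rw [segment_eq_Icc (hm (left_mem_Icc.mpr hab) (right_mem_Icc.mpr hab) hab)]
    refine Subset.antisymm ?_ (intermediate_value_Icc hab hc)
    rintro _ ⟨s, hs, rfl⟩
    exact ⟨hm (left_mem_Icc.mpr hab) hs hs.1, hm hs (right_mem_Icc.mpr hab) hs.2⟩
  have hline : ∀ s ∈ Icc a b, f s = AffineMap.lineMap p (p + v) (h s) := fun s hs => by
    rw [hf s hs, AffineMap.lineMap_apply]
    simp [add_comm]
  rw [image_congr hline, ← image_image (AffineMap.lineMap p (p + v)) h, himg, image_segment,
    ← hline a (left_mem_Icc.mpr hab), ← hline b (right_mem_Icc.mpr hab)]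

section ChronCurve

variable {f : ℝ → M4}

theorem chron_curve_timelike_and_coord_ne {s t : ℝ}
    (hmono : ∀ s t : ℝ, s ∈ Icc (0 : ℝ) 1 → t ∈ Icc (0 : ℝ) 1 → s < t → Chron (f s) (f t))
    (hs : s ∈ Icc (0 : ℝ) 1) (ht : t ∈ Icc (0 : ℝ) 1) (hst : s ≠ t) :
    0 < Q (f s - f t) ∧ (f s - f t) 0 ≠ 0 := by
  rcases lt_or_gt_of_ne hst with h | h
  · have := hmono s t hs ht h
    rw [← neg_sub (f t) (f s), Q_neg]
    exact ⟨this.1, by rw [PiLp.neg_apply]; exact neg_ne_zero.mpr this.2.ne'⟩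
  · have := hmono t s ht hs h
    exact ⟨this.1, this.2.ne'⟩

theorem chron_curve_finite_directions {c : ℝ}
    (hcont : @ContinuousOn ℝ M4 _ Ftop f (Icc 0 1))
    (hmono : ∀ s t : ℝ, s ∈ Icc (0 : ℝ) 1 → t ∈ Icc (0 : ℝ) 1 → s < t → Chron (f s) (f t))
    (hc : c ∈ Icc (0 : ℝ) 1) :
    ∃ s ∈ 𝓝[Icc 0 1 \ {c}] c, ((fun t => timeDirection (f t - f c)) '' s).Finite := by
  by_contra! hinf
  obtain ⟨u, hu, hinj⟩ := exists_seq_tendsto_injective_comp hinf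
  obtain ⟨N, hN⟩ := eventually_atTop.mp (hu.eventually self_mem_nhdsWithin)
  set w : ℕ → ℝ := fun n => u (n + N)
  have hw : ∀ n, w n ∈ Icc (0 : ℝ) 1 \ {c} := fun n => hN _ (Nat.le_add_left _ _)
  have hwc : Tendsto w atTop (𝓝[Icc 0 1] c) :=
    (hu.comp (tendsto_add_atTop_nat N)).mono_right (nhdsWithin_mono _ sdiff_subset)
  have hfw : Tendsto (f ∘ w) atTop (@nhds M4 Ftop (f c)) := Tendsto.comp (hcont c hc) hwc
  have hclosed : IsClosed[Ftop] (range (f ∘ w)) := by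
    refine isClosed_Ftop_range (p := f c) (hfw.mono_right (_root_.nhds_mono Ftop_le_euclidean)) ?_ ?_ ?_
    · intro m n hmn
      exact (chron_curve_timelike_and_coord_ne hmono (hw m).1 (hw n).1 fun h => hmn (congrArg f h)).1
    · exact fun n => (chron_curve_timelike_and_coord_ne hmono (hw n).1 hc (hw n).2).2
    · exact fun m n hmn => Nat.add_right_cancel (hinj hmn)
  have hnot : f c ∉ range (f ∘ w) := by
    rintro ⟨n, hn⟩
    refine (chron_curve_timelike_and_coord_ne hmono (hw n).1 hc (hw n).2).2 ?_
    simp only [Function.comp_apply] at hn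
    simp [hn]
  have hev := hfw.eventually 
    (@IsOpen.mem_nhds M4 Ftop _ _ (@IsClosed.isOpen_compl _ Ftop _ hclosed) hnot)
  obtain ⟨n, hn⟩ := hev.exists
  exact hn (mem_range_self n)

theorem chron_curve_locally_segment {c : ℝ}
    (hcont : @ContinuousOn ℝ M4 _ Ftop f (Icc 0 1))
    (hmono : ∀ s t : ℝ, s ∈ Icc (0 : ℝ) 1 → t ∈ Icc (0 : ℝ) 1 → s < t → Chron (f s) (f t))
    (hc : c ∈ Icc (0 : ℝ) 1) :
    ∃ ε > 0, ∀ a b, a ∈ Icc (0 : ℝ) 1 → b ∈ Icc (0 : ℝ) 1 → a < b → b - a < ε →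
      (a = c ∨ b = c) → f '' Icc a b = segment ℝ (f a) (f b) := by
  have hcE : ContinuousOn f (Icc 0 1) := fun t ht =>
    Tendsto.mono_right (hcont t ht) (_root_.nhds_mono Ftop_le_euclidean)
  have hcoord : ContinuousOn (fun t => (f t - f c) 0) (Icc 0 1) := by fun_prop
  have hmonoOn : MonotoneOn (fun t => (f t - f c) 0) (Icc 0 1) := by
    refine StrictMonoOn.monotoneOn fun s hs t ht hst => ?_
    have := (hmono s t hs ht hst).2
    simp only [PiLp.sub_apply] at this ⊢
    linarith
  have hdir : ContinuousOn (fun t => timeDirection (f t - f c)) (Icc 0 1 \ {c}) := by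
    refine ContinuousOn.smul (ContinuousOn.inv₀ (hcoord.mono sdiff_subset) fun t ht => ?_)
      ((hcE.mono sdiff_subset).sub continuousOn_const)
    exact (chron_curve_timelike_and_coord_ne hmono ht.1 hc ht.2).2
  obtain ⟨s, hs, hfin⟩ := chron_curve_finite_directions hcont hmono hc
  obtain ⟨ε, hε, hball⟩ := Metric.mem_nhdsWithin_iff.mp hs
  refine ⟨ε, hε, fun a b ha hb hab hlt hor => ?_⟩
  have hsub : Icc a b ⊆ Icc 0 1 := Icc_subset_Icc ha.1 hb.2
  have hconn : IsPreconnected (Icc a b \ {c}) := by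
    rcases hor with rfl | rfl
    · rw [Icc_sdiff_left]; exact isPreconnected_Ioc
    · rw [Icc_sdiff_right]; exact isPreconnected_Ico
  have hss : Icc a b \ {c} ⊆ s := fun t ht => hball ⟨by
    rw [Metric.mem_ball, Real.dist_eq, abs_lt]
    rcases hor with rfl | rfl <;> constructor <;> linarith [ht.1.1, ht.1.2],
    hsub ht.1, ht.2⟩
  have himg : ((fun t => timeDirection (f t - f c)) '' (Icc a b \ {c})).Subsingleton := by
    rw [← not_nontrivial_iff]
    intro hnt
    exact (hconn.image _ (hdir.mono (sdiff_subset_sdiff_left hsub))).infinite_of_nontrivial hnt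
      (hfin.subset (image_mono hss))
  obtain ⟨v, hv⟩ : ∃ v, ∀ t ∈ Icc a b \ {c}, timeDirection (f t - f c) = v := by
    rcases himg.eq_empty_or_singleton with h | ⟨v, h⟩
    · exact ⟨0, fun t ht => absurd (mem_image_of_mem _ ht) (h ▸ notMem_empty _)⟩
    · exact ⟨v, fun t ht => mem_singleton_iff.mp
        (h ▸ mem_image_of_mem (fun t => timeDirection (f t - f c)) ht)⟩
  refine image_Icc_eq_segment (p := f c) (v := v) hab.le (hcoord.mono hsub) (hmonoOn.mono hsub)
    fun t ht => ?_
  by_cases htc : t = c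
  · simp [htc]
  · rw [← hv t ⟨ht, htc⟩, smul_timeDirection (chron_curve_timelike_and_coord_ne hmono (hsub ht) hc htc).2]
    abel

end ChronCurve

theorem exists_fin_chain {α : Type*} {r : α → α → Prop} {a b : α}
    (h : Relation.ReflTransGen r a b) :
    ∃ n : ℕ, ∃ τ : Fin (n + 1) → α, τ 0 = a ∧ τ (Fin.last n) = b ∧
      ∀ i : Fin n, r (τ i.castSucc) (τ i.succ) := by
  induction h with
  | refl => exact ⟨0, fun _ => a, rfl, rfl, fun i => i.elim0⟩
  | @tail b c _ hbc ih =>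
    obtain ⟨n, τ, h0, hn, hτ⟩ := ih
    refine ⟨n + 1, Fin.snoc (α := fun _ => α) τ c, ?_, Fin.snoc_last _ _, fun i => ?_⟩
    · rw [← h0, ← Fin.castSucc_zero, Fin.snoc_castSucc]
    · refine Fin.lastCases ?_ (fun j => ?_) i
      · rw [Fin.succ_last, Fin.snoc_last, Fin.snoc_castSucc, hn]
        exact hbc
      · rw [← Fin.castSucc_succ, Fin.snoc_castSucc, Fin.snoc_castSucc]
        exact hτ j

/-- A relation on `[a, b]` that holds locally on both sides of every point chains `a` to `b`. -/
theorem reflTransGen_of_locally {r : ℝ → ℝ → Prop} {a b : ℝ} (hab : a ≤ b)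
    (h : ∀ c ∈ Icc a b, ∃ ε > 0, ∀ s t, s ∈ Icc a b → t ∈ Icc a b → s < t → t - s < ε →
      (s = c ∨ t = c) → r s t) :
    Relation.ReflTransGen r a b := by
  set G : Set ℝ := {x | x ∈ Icc a b ∧ Relation.ReflTransGen r a x}
  have haG : a ∈ G := ⟨left_mem_Icc.mpr hab, .refl⟩
  have hbdd : BddAbove G := ⟨b, fun x hx => hx.1.2⟩
  have hc : sSup G ∈ Icc a b := ⟨le_csSup hbdd haG, csSup_le ⟨a, haG⟩ fun x hx => hx.1.2⟩
  obtain ⟨ε, hε, hloc⟩ := h _ hc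
  have hcG : Relation.ReflTransGen r a (sSup G) := by
    obtain ⟨x, hx, hlt⟩ := exists_lt_of_lt_csSup ⟨a, haG⟩ (sub_lt_self (sSup G) hε)
    rcases (le_csSup hbdd hx).eq_or_lt with heq | hxc
    · exact heq ▸ hx.2
    · exact hx.2.tail (hloc x _ hx.1 hc hxc (by linarith) (Or.inr rfl))
  rcases hc.2.eq_or_lt with heq | hlt
  · exact heq ▸ hcG
  · obtain ⟨y, hy, hy'⟩ := exists_between (lt_min hlt (lt_add_of_pos_right (sSup G) hε))
    have hyI : y ∈ Icc a b := ⟨hc.1.trans hy.le, (hy'.trans_le (min_le_left _ _)).le⟩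
    have hyε := hy'.trans_le (min_le_right _ _)
    have hyG : y ∈ G := ⟨hyI, hcG.tail (hloc _ y hc hyI hy (by linarith) (Or.inl rfl))⟩
    exact absurd (le_csSup hbdd hyG) hy.not_ge

/-- Theorem 2.1 (Zeeman): if `f : [0,1] → M` is continuous for the fine
Zeeman topology `F` and strictly order-preserving for the chronological
order `≪`, then `f([0,1])` is a piecewise linear path consisting of a finite
number of timelike straight segments (intervals along time axes). -/
theorem fine_zeeman_chron_curves_piecewise_linear
    (f : ℝ → M4)
    (hcont : @ContinuousOn ℝ M4 _ Ftop f (Set.Icc 0 1))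
    (hmono : ∀ s t : ℝ, s ∈ Set.Icc (0 : ℝ) 1 → t ∈ Set.Icc (0 : ℝ) 1 →
      s < t → Chron (f s) (f t)) :
    ∃ n : ℕ, ∃ τ : Fin (n + 1) → ℝ,
      StrictMono τ ∧ τ 0 = 0 ∧ τ (Fin.last n) = 1 ∧
      ∀ i : Fin n,
        f '' Set.Icc (τ i.castSucc) (τ i.succ) =
          segment ℝ (f (τ i.castSucc)) (f (τ i.succ)) ∧
        0 < Q (f (τ i.succ) - f (τ i.castSucc)) := by
  have hchain : Relation.ReflTransGen (fun a b => a < b ∧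
      f '' Icc a b = segment ℝ (f a) (f b) ∧ 0 < Q (f b - f a)) 0 1 := by
    refine reflTransGen_of_locally zero_le_one fun c hc => ?_
    obtain ⟨ε, hε, h⟩ := chron_curve_locally_segment hcont hmono hc
    exact ⟨ε, hε, fun a b ha hb hab hlt hor =>
      ⟨hab, h a b ha hb hab hlt hor, (hmono a b ha hb hab).1⟩⟩
  obtain ⟨n, τ, h0, h1, hτ⟩ := exists_fin_chain hchain
  exact ⟨n, τ, Fin.strictMono_iff_lt_succ.mpr fun i => (hτ i).1, h0, h1, fun i => (hτ i).2⟩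
end
end
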